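/- In the polynomial ring R[d,e,f] the following identity holds: 4(d² + e² + f²)³ − 108 d²e²f² = 27(−de² + df²)² + (−2d³ + de² + df²)² + 4(−2d²e + e³ + ef²)² + 4(2d²f − e²f − f³)². In particular, the discriminant of the symmetric matrix [[0,d,e],[d,0,f],[e,f,0]] with zero diagonal, which equals 4(d² + e² + f²)³ − 108 d²e²f², is a sum of four squares of polynomials. -/

import Mathlib

open Matrix MvPolynomial BigOperators

/-- The discriminant of a real symmetric (Hermitian) matrix: the product of the squared
differences of its eigenvalues. -/
noncomputable def disc {n : ℕ} (A : Matrix (Fin n) (Fin n) ℝ) (hA : A.IsHermitian) : ℝ :=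
  ∏ i : Fin n, ∏ j ∈ Finset.Ioi i, (hA.eigenvalues i - hA.eigenvalues j) ^ 2

noncomputable def d : MvPolynomial (Fin 3) ℝ := X 0
noncomputable def e : MvPolynomial (Fin 3) ℝ := X 1
noncomputable def f : MvPolynomial (Fin 3) ℝ := X 2

/-- The discriminant `4(d² + e² + f²)³ - 108 d²e²f²` of the symmetric matrix
`[[0,d,e],[d,0,f],[e,f,0]]` is the given explicit sum of four squares of polynomials. -/
theorem discriminant_zero_diagonal_sum_four_squares :
    (4*(d^2 + e^2 + f^2)^3 - 108 * d^2*e^2*f^2 =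
      27*(-d*e^2 + d*f^2)^2 + (-2*d^3 + d*e^2 + d*f^2)^2
      + 4*(-2*d^2*e + e^3 + e*f^2)^2 + 4*(2*d^2*f - e^2*f - f^3)^2) ∧
    (∀ (x y z : ℝ) (h : (!![0, x, y; x, 0, z; y, z, 0]).IsHermitian),
      disc _ h = 4*(x^2 + y^2 + z^2)^3 - 108 * x^2*y^2*z^2) ∧
    ∃ g : Fin 4 → MvPolynomial (Fin 3) ℝ,
      4*(d^2 + e^2 + f^2)^3 - 108 * d^2*e^2*f^2 = ∑ i, (g i)^2 := by
  have key : 4*(d^2 + e^2 + f^2)^3 - 108 * d^2*e^2*f^2 =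
      27*(-d*e^2 + d*f^2)^2 + (-2*d^3 + d*e^2 + d*f^2)^2
      + 4*(-2*d^2*e + e^3 + e*f^2)^2 + 4*(2*d^2*f - e^2*f - f^3)^2 := by ring
  refine ⟨key, ?_, ?_⟩
  · intro x y z h
    have hc := h.charpoly_eq
    have ev : ∀ t : ℝ, t^3 - (x^2+y^2+z^2)*t - 2*x*y*z =
        (t - h.eigenvalues 0) * (t - h.eigenvalues 1) * (t - h.eigenvalues 2) := by
      intro t
      have h1 := congrArg (Polynomial.eval t) hc
      rw [Matrix.eval_charpoly, Matrix.det_fin_three] at h1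
      simp [Fin.prod_univ_three, Polynomial.eval_mul] at h1
      rw [← h1]
      ring
    have hd : disc _ h = ((h.eigenvalues 0 - h.eigenvalues 1)^2 *
        (h.eigenvalues 0 - h.eigenvalues 2)^2) * (h.eigenvalues 1 - h.eigenvalues 2)^2 := by
      have i0 : Finset.Ioi (0 : Fin 3) = {1, 2} := by decide
      have i1 : Finset.Ioi (1 : Fin 3) = {2} := by decide
      have i2 : Finset.Ioi (2 : Fin 3) = ∅ := by decide
      rw [disc, Fin.prod_univ_three, i0, i1, i2]
      simp
    rw [hd]
    generalize h.eigenvalues 0 = a at *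
    generalize h.eigenvalues 1 = b at *
    generalize h.eigenvalues 2 = c at *
    have e0 := ev 0
    have e1 := ev 1
    have e2 := ev (-1)
    have s1 : c = -a - b := by linarith
    subst s1
    have s2 : x^2+y^2+z^2 = a^2 + a*b + b^2 := by linarith
    have s3 : 2*(x*y*z) = -(a*b*(a+b)) := by linarith
    have s4 : 108 * x^2*y^2*z^2 = 27 * (2*(x*y*z))^2 := by ring
    rw [s4, s3, s2]
    ring
  · have hs : (C (Real.sqrt 27) : MvPolynomial (Fin 3) ℝ)^2 = 27 := by
      rw [← C_pow, Real.sq_sqrt (by norm_num)]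
      exact map_ofNat C 27
    refine ⟨![C (Real.sqrt 27) * (-d*e^2 + d*f^2), -2*d^3 + d*e^2 + d*f^2,
      2*(-2*d^2*e + e^3 + e*f^2), 2*(2*d^2*f - e^2*f - f^3)], ?_⟩
    rw [key, Fin.sum_univ_four]
    simp only [Matrix.cons_val, mul_pow, hs]
    ring
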